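/- For k ≥ 0, |A_{ℤ[i],2k+1}| = 14·4^{k+1} − 34·2^{k+1} + 8k + 29, and for k ≥ 1, |A_{ℤ[i],2k}| = 28·4^k − 48·2^k + 8k + 25. -/

import Mathlib

def MotzkinSet : ℕ → Set GaussianInt
  | 0 => {z | z = 0 ∨ IsUnit z}
  | n + 1 => MotzkinSet n ∪ {β | ∀ x : GaussianInt, ∃ r ∈ MotzkinSet n, β ∣ (x - r)}

/-- The widths of the octagons. -/
def ww : ℕ → ℤ
  | 0 => 3
  | 1 => 4
  | n + 2 => 2 * ww n

/-- Membership in the octagon, shrunk by `E`. -/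
def Bd (n : ℕ) (E x y : ℤ) : Prop :=
  x ≤ ww n - 2 * E ∧ -x ≤ ww n - 2 * E ∧ y ≤ ww n - 2 * E ∧ -y ≤ ww n - 2 * E ∧
  x + y ≤ ww (n+1) - 3 * E ∧ x - y ≤ ww (n+1) - 3 * E ∧
  -x + y ≤ ww (n+1) - 3 * E ∧ -x - y ≤ ww (n+1) - 3 * E

def InC (n : ℕ) (x y : ℤ) : Prop :=
  (x = 0 ∧ y = 0) ∨ ∀ j : ℕ, (2:ℤ)^j ∣ x → (2:ℤ)^j ∣ y → Bd n (2^j) x y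

lemma ww_two (n : ℕ) : ww (n+2) = 2 * ww n := rfl

lemma ww_form (n : ℕ) : ∃ k : ℕ, (n = 2 * k ∧ ww n = 3 * 2^k ∧ ww (n+1) = 4 * 2^k) ∨
    (n = 2 * k + 1 ∧ ww n = 4 * 2^k ∧ ww (n+1) = 6 * 2^k) := by
  induction n with
  | zero => exact ⟨0, by simp [ww]⟩
  | succ n ih =>
    obtain ⟨k, ⟨h0, h1, h2⟩ | ⟨h0, h1, h2⟩⟩ := ih
    · refine ⟨k, Or.inr ⟨by omega, h2, ?_⟩⟩
      rw [ww_two, h1]; ring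
    · refine ⟨k+1, Or.inl ⟨by omega, ?_, ?_⟩⟩
      · rw [h2]; ring
      · rw [ww_two, h1]; ring

lemma two_pow_cases (j k : ℕ) : ((2:ℤ)^k = 2^j) ∨ (∃ m : ℤ, 1 ≤ m ∧ (2:ℤ)^k = 2^j * (2 * m)) ∨
    (∃ m : ℤ, 1 ≤ m ∧ (2:ℤ)^j = 2^k * (2 * m)) := by
  rcases lt_trichotomy j k with h | h | h
  · obtain ⟨t, rfl⟩ := Nat.exists_eq_add_of_lt h
    exact Or.inr (Or.inl ⟨2^t, one_le_pow₀ (by norm_num), by ring⟩)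
  · left; rw [h]
  · obtain ⟨t, rfl⟩ := Nat.exists_eq_add_of_lt h
    exact Or.inr (Or.inr ⟨2^t, one_le_pow₀ (by norm_num), by ring⟩)

lemma ww_mono (n : ℕ) : ww n ≤ ww (n+1) := by
  obtain ⟨k, ⟨_, h1, h2⟩ | ⟨_, h1, h2⟩⟩ := ww_form n <;>
  · have : (0:ℤ) < 2^k := by positivity
    linarith

lemma InC_mono {n : ℕ} {x y : ℤ} (h : InC n x y) : InC (n+1) x y := by
  rcases h with h | h
  · exact Or.inl h
  · right
    intro j hx hy
    have := h j hx hy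
    have h1 := ww_mono n
    have h2 := ww_mono (n+1)
    unfold Bd at *
    refine ⟨?_, ?_, ?_, ?_, ?_, ?_, ?_, ?_⟩ <;> linarith

lemma InC_odd {n : ℕ} {x y : ℤ} (ho : (x + y) % 2 = 1) (h : Bd n 1 x y) : InC n x y := by
  right
  intro j hx hy
  rcases Nat.eq_zero_or_pos j with rfl | hj
  · simpa using h
  · exfalso
    have h2 : (2:ℤ) ∣ 2^j := dvd_pow_self _ (by omega)
    have := h2.trans hx
    have := h2.trans hy
    omega

lemma InC_rot {n : ℕ} {x y : ℤ} (h : InC n x y) : InC n (-y) x := by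
  rcases h with h | h
  · left; omega
  · right
    intro j hx hy
    have := h j hy (by simpa using hx)
    unfold Bd at *
    refine ⟨?_, ?_, ?_, ?_, ?_, ?_, ?_, ?_⟩ <;> linarith

lemma InC_swap {n : ℕ} {x y : ℤ} (h : InC n x y) : InC n y x := by
  rcases h with h | h
  · left; omega
  · right
    intro j hx hy
    have := h j hy hx
    unfold Bd at *
    refine ⟨?_, ?_, ?_, ?_, ?_, ?_, ?_, ?_⟩ <;> linarith

/-- scale inequality -/
lemma le_of_scaled {E u v : ℤ} (hE : 0 < E) : E * u ≤ E * v ↔ u ≤ v :=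
  mul_le_mul_iff_right₀ hE

lemma core_odd {n : ℕ} {a b c d : ℤ} (hb : 0 ≤ b) (hab : b < a) (ho : (a + b) % 2 = 1)
    (ha : a ≤ ww (n+1) - 2) (hs : a + b ≤ ww (n+2) - 3)
    (hd1 : d ≤ c) (hd2 : -d ≤ c) (hc : 2 * c < a + b) (hcd1 : c + d < a) (hcd2 : c - d < a) :
    InC n c d ∨ InC n (c-a) (d-b) ∨ InC n (c-b) (d+a) := by
  by_cases h : InC n c d
  · exact Or.inl h
  right
  have h' := h
  unfold InC at h'
  push Not at h'
  obtain ⟨h0, j, hjc, hjd, hB⟩ := h'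
  rw [ww_two] at hs
  rcases Nat.eq_zero_or_pos j with rfl | hj
  · exfalso; apply hB
    unfold Bd
    simp only [pow_zero]
    omega
  have hE2 : (2:ℤ) ∣ 2^j := dvd_pow_self _ (by omega)
  have hc2 := hE2.trans hjc
  have hd2' := hE2.trans hjd
  obtain ⟨c', hc'⟩ := hjc
  obtain ⟨d', hd'⟩ := hjd
  have hEpos : (0:ℤ) < 2^j := by positivity
  suffices hh : Bd n 1 (c-a) (d-b) ∨ Bd n 1 (c-b) (d+a) by
    rcases hh with hh | hh
    · exact Or.inl (InC_odd (by omega) hh)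
    · exact Or.inr (InC_odd (by omega) hh)
  have hcpos : 0 < c := by omega
  have hc'pos : 0 < c' := by
    rw [hc'] at hcpos; exact pos_of_mul_pos_right hcpos hEpos.le
  have hEc : (2:ℤ)^j ≤ c := by rw [hc']; nlinarith
  generalize hE : (2:ℤ)^j = E at *
  obtain ⟨k, ⟨_, h1, h2⟩ | ⟨_, h1, h2⟩⟩ := ww_form n
  · have hP : (0:ℤ) < 2^k := by positivity
    have key : (∃ m : ℤ, 1 ≤ m ∧ (2:ℤ)^k = E * m) ∨ (E = 2 * 2^k) := by
      rcases two_pow_cases j k with h | ⟨m, hm, h⟩ | ⟨m, hm, h⟩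
      · left; exact ⟨1, le_rfl, by rw [h, hE]; ring⟩
      · left; exact ⟨2*m, by omega, by rw [h, hE]⟩
      · right
        rw [hE] at h
        have : m < 2 := by
          by_contra hm2
          push Not at hm2
          have : 2^k * (2*2) ≤ (2:ℤ)^k * (2*m) := by
            apply mul_le_mul_of_nonneg_left _ hP.le; omega
          omega
        have : m = 1 := by omega
        rw [h, this]; ring
    unfold Bd at *
    simp only [h1, h2] at ha hs hB ⊢
    rcases key with ⟨m, hm, hPm⟩ | hEP
    · have hl : c ≥ 3 * 2^k - E ∨ c + d ≥ 4 * 2^k - 2 * E ∨ c - d ≥ 4 * 2^k - 2 * E := by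
        by_contra hcon
        push Not at hcon
        obtain ⟨g1, g2, g3⟩ := hcon
        apply hB
        rw [hPm] at g1 g2 g3 ⊢
        rw [hc'] at g1 g2 g3 ⊢
        rw [hd'] at g2 g3 ⊢
        rw [hc', hd'] at hd1 hd2
        have e1 : c' < 3 * m - 1 := by
          apply lt_of_mul_lt_mul_left _ hEpos.le; linarith
        have e2 : c' + d' < 4 * m - 2 := by
          apply lt_of_mul_lt_mul_left _ hEpos.le; linarith
        have e3 : c' - d' < 4 * m - 2 := by
          apply lt_of_mul_lt_mul_left _ hEpos.le; linarith
        have f1 : E * c' ≤ E * (3 * m - 2) := (le_of_scaled hEpos).2 (by omega)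
        have f2 : E * (c' + d') ≤ E * (4 * m - 3) := (le_of_scaled hEpos).2 (by omega)
        have f3 : E * (c' - d') ≤ E * (4 * m - 3) := (le_of_scaled hEpos).2 (by omega)
        refine ⟨?_, ?_, ?_, ?_, ?_, ?_, ?_, ?_⟩ <;> linarith
      have hEP : E ≤ 2^k := by rw [hPm]; nlinarith
      have hP2 : (2:ℤ)^k % 2 = 0 := by
        have : (2:ℤ) ∣ 2^k := by rw [hPm]; exact hE2.mul_right _
        omega
      have x1 : d ≤ -2^k ∨ -2^k + E ≤ d := by
        rw [hPm, hd']
        rcases le_or_gt d' (-m) with q | q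
        · left; have := (le_of_scaled hEpos).2 q; linarith
        · right; have := (le_of_scaled hEpos).2 (show -m + 1 ≤ d' by omega); linarith
      have x2 : 2 * 2^k ≤ c + d ∨ c + d ≤ 2 * 2^k - E := by
        rw [hPm, hc', hd']
        rcases le_or_gt (2 * m) (c' + d') with q | q
        · left; have := (le_of_scaled hEpos).2 q; linarith
        · right; have := (le_of_scaled hEpos).2 (show c' + d' ≤ 2 * m - 1 by omega); linarith
      generalize (2:ℤ)^k = P at *
      clear hPm hc' hd' hE hB h
      omega
    · have : c' = 1 := by
        have : c' < 2 := by
          by_contra hcon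
          push Not at hcon
          have : E * 2 ≤ E * c' := (le_of_scaled hEpos).2 hcon
          omega
        omega
      have hd0 : d' = 0 := by
        have l1 : d' < 1 := by
          by_contra hcon
          push Not at hcon
          have : E * 1 ≤ E * d' := (le_of_scaled hEpos).2 hcon
          omega
        have l2 : -1 < d' := by
          by_contra hcon
          push Not at hcon
          have : E * d' ≤ E * (-1) := (le_of_scaled hEpos).2 hcon
          omega
        omega
      subst this hd0
      simp only [mul_one, mul_zero] at hc' hd'
      generalize (2:ℤ)^k = P at *
      clear hB h
      omega
  · have hP : (0:ℤ) < 2^k := by positivity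
    have key : (∃ m : ℤ, 1 ≤ m ∧ 2 * (2:ℤ)^k = E * m) := by
      rcases two_pow_cases j k with h | ⟨m, hm, h⟩ | ⟨m, hm, h⟩
      · exact ⟨2, by norm_num, by rw [h, hE]; ring⟩
      · exact ⟨4*m, by omega, by rw [h, hE]; ring⟩
      · rw [hE] at h
        have : m < 2 := by
          by_contra hm2
          push Not at hm2
          have : 2^k * (2*2) ≤ (2:ℤ)^k * (2*m) := by
            apply mul_le_mul_of_nonneg_left _ hP.le; omega
          omega
        have : m = 1 := by omega
        refine ⟨1, le_rfl, ?_⟩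
        rw [h, this]; ring
    unfold Bd at *
    simp only [h1, h2] at ha hs hB ⊢
    obtain ⟨m, hm, hPm⟩ := key
    have hl : c ≥ 4 * 2^k - E ∨ c + d ≥ 6 * 2^k - 2 * E ∨ c - d ≥ 6 * 2^k - 2 * E := by
      by_contra hcon
      push Not at hcon
      obtain ⟨g1, g2, g3⟩ := hcon
      apply hB
      have q4 : 4 * (2:ℤ)^k = 2 * (E * m) := by linarith
      have q6 : 6 * (2:ℤ)^k = 3 * (E * m) := by linarith
      rw [q4] at g1 ⊢
      rw [q6] at g2 g3 ⊢
      rw [hc'] at g1 g2 g3 ⊢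
      rw [hd'] at g2 g3 ⊢
      rw [hc', hd'] at hd1 hd2
      have e1 : c' < 2 * m - 1 := by
        apply lt_of_mul_lt_mul_left _ hEpos.le; linarith
      have e2 : c' + d' < 3 * m - 2 := by
        apply lt_of_mul_lt_mul_left _ hEpos.le; linarith
      have e3 : c' - d' < 3 * m - 2 := by
        apply lt_of_mul_lt_mul_left _ hEpos.le; linarith
      have f1 : E * c' ≤ E * (2 * m - 2) := (le_of_scaled hEpos).2 (by omega)
      have f2 : E * (c' + d') ≤ E * (3 * m - 3) := (le_of_scaled hEpos).2 (by omega)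
      have f3 : E * (c' - d') ≤ E * (3 * m - 3) := (le_of_scaled hEpos).2 (by omega)
      refine ⟨?_, ?_, ?_, ?_, ?_, ?_, ?_, ?_⟩ <;> linarith
    have hEP : E ≤ 2 * 2^k := by rw [hPm]; nlinarith
    have x0 : E = 2 * 2^k ∨ E ≤ 2^k := by
      rcases eq_or_lt_of_le hm with q | q
      · left; rw [hPm, ← q]; ring
      · right; have := (le_of_scaled hEpos).2 (show 2 ≤ m by omega); linarith
    have x1 : d ≤ -(2*2^k) ∨ -(2*2^k) + E ≤ d := by
      rw [hPm, hd']
      rcases le_or_gt d' (-m) with q | q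
      · left; have := (le_of_scaled hEpos).2 q; linarith
      · right; have := (le_of_scaled hEpos).2 (show -m + 1 ≤ d' by omega); linarith
    have x2 : 2 * 2^k ≤ c + d ∨ c + d ≤ 2 * 2^k - E := by
      rw [hPm, hc', hd']
      rcases le_or_gt m (c' + d') with q | q
      · left; have := (le_of_scaled hEpos).2 q; linarith
      · right; have := (le_of_scaled hEpos).2 (show c' + d' ≤ m - 1 by omega); linarith
    generalize (2:ℤ)^k = P at *
    clear hPm hc' hd' hE hB h
    omega

def Good (n : ℕ) (a b c d : ℤ) : Prop :=
  ∃ p q : ℤ, InC n (c - (a * p - b * q)) (d - (a * q + b * p))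

def Cov (n : ℕ) (a b : ℤ) : Prop := ∀ x y : ℤ, Good n a b x y

lemma Good_rot {n : ℕ} {a b c d : ℤ} (h : Good n a b c d) : Good n a b (-d) c := by
  obtain ⟨p, q, h⟩ := h
  refine ⟨-q, p, ?_⟩
  convert InC_rot h using 1 <;> ring

lemma Good_shift {n : ℕ} {a b c d : ℤ} (p q : ℤ)
    (h : Good n a b (c - (a * p - b * q)) (d - (a * q + b * p))) : Good n a b c d := by
  obtain ⟨p', q', h⟩ := h
  refine ⟨p + p', q + q', ?_⟩
  convert h using 1 <;> ring

lemma Cov_rot {n : ℕ} {a b : ℤ} (h : Cov n a b) : Cov n (-b) a := by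
  intro x y
  obtain ⟨p, q, h⟩ := h x y
  refine ⟨q, -p, ?_⟩
  convert h using 1 <;> ring

lemma Cov_swap {n : ℕ} {a b : ℤ} (h : Cov n a b) : Cov n b a := by
  intro x y
  obtain ⟨p, q, h⟩ := h y x
  refine ⟨p, -q, ?_⟩
  convert InC_swap h using 1 <;> ring

lemma exists_round (p N : ℤ) (hN : 0 < N) (ho : N % 2 = 1) :
    ∃ m : ℤ, 2 * (p - m * N) ≤ N - 1 ∧ -(N - 1) ≤ 2 * (p - m * N) := by
  refine ⟨(2 * p + N) / (2 * N), ?_⟩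
  have h1 := Int.emod_add_mul_ediv (2 * p + N) (2 * N)
  have h2 := Int.emod_nonneg (2 * p + N) (show 2 * N ≠ 0 by omega)
  have h3 := Int.emod_lt_of_pos (2 * p + N) (show 0 < 2 * N by omega)
  generalize (2 * p + N) / (2 * N) = m at *
  generalize (2 * p + N) % (2 * N) = r at *
  have h4 : 2 * N * m = 2 * (m * N) := by ring
  rw [h4] at h1
  generalize m * N = t at *
  omega

lemma Good_sector {n : ℕ} {a b c d : ℤ} (hb : 0 ≤ b) (hab : b < a) (ho : (a + b) % 2 = 1)
    (ha : a ≤ ww (n+1) - 2) (hs : a + b ≤ ww (n+2) - 3)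
    (hd1 : d ≤ c) (hd2 : -d ≤ c) (hc : 2 * c < a + b) (hcd1 : c + d < a) (hcd2 : c - d < a) :
    Good n a b c d := by
  rcases core_odd hb hab ho ha hs hd1 hd2 hc hcd1 hcd2 with h | h | h
  · exact ⟨0, 0, by simpa using h⟩
  · exact ⟨1, 0, by simpa using h⟩
  · exact ⟨0, -1, by simpa using h⟩

lemma Cov_odd {n : ℕ} {a b : ℤ} (hb : 0 ≤ b) (hab : b < a) (ho : (a + b) % 2 = 1)
    (ha : a ≤ ww (n+1) - 2) (hs : a + b ≤ ww (n+2) - 3) : Cov n a b := by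
  intro x y
  have hN : 0 < a * a + b * b := by nlinarith
  have hNo : (a * a + b * b) % 2 = 1 := by
    have : a * a + b * b = (a + b) * (a + b) - 2 * (a * b) := by ring
    have h2 : ((a + b) * (a + b)) % 2 = 1 := by rw [Int.mul_emod, ho]; rfl
    omega
  obtain ⟨m, hm1, hm2⟩ := exists_round (a * x + b * y) _ hN hNo
  obtain ⟨l, hl1, hl2⟩ := exists_round (a * y - b * x) _ hN hNo
  apply Good_shift m l
  have e1 : a * x + b * y - m * (a * a + b * b) =
    a * (x - (a * m - b * l)) + b * (y - (a * l + b * m)) := by ring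
  have e2 : a * y - b * x - l * (a * a + b * b) =
    a * (y - (a * l + b * m)) - b * (x - (a * m - b * l)) := by ring
  rw [e1] at hm1 hm2
  rw [e2] at hl1 hl2
  generalize x - (a * m - b * l) = c at *
  generalize y - (a * l + b * m) = d at *
  clear e1 e2
  generalize hNN : a * a + b * b = N at *
  have ha0 : 0 < a := by omega
  have A1 := mul_le_mul_of_nonneg_left hm1 ha0.le
  have A2 := mul_le_mul_of_nonneg_left hm2 ha0.le
  have A3 := mul_le_mul_of_nonneg_left hl1 ha0.le
  have A4 := mul_le_mul_of_nonneg_left hl2 ha0.le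
  have B1 := mul_le_mul_of_nonneg_left hm1 hb
  have B2 := mul_le_mul_of_nonneg_left hm2 hb
  have B3 := mul_le_mul_of_nonneg_left hl1 hb
  have B4 := mul_le_mul_of_nonneg_left hl2 hb
  have c1 : 2 * c < a + b := by
    apply lt_of_mul_lt_mul_right _ hN.le
    have : 2 * c * N = 2 * c * (a * a + b * b) := by rw [hNN]
    linarith
  have c2 : 2 * (-c) < a + b := by
    apply lt_of_mul_lt_mul_right _ hN.le
    have : 2 * c * N = 2 * c * (a * a + b * b) := by rw [hNN]
    linarith
  have c3 : 2 * d < a + b := by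
    apply lt_of_mul_lt_mul_right _ hN.le
    have : 2 * d * N = 2 * d * (a * a + b * b) := by rw [hNN]
    linarith
  have c4 : 2 * (-d) < a + b := by
    apply lt_of_mul_lt_mul_right _ hN.le
    have : 2 * d * N = 2 * d * (a * a + b * b) := by rw [hNN]
    linarith
  have hab0 : 0 < a - b := by omega
  have D1 := mul_le_mul_of_nonneg_left hm1 hab0.le
  have D2 := mul_le_mul_of_nonneg_left hm2 hab0.le
  have D3 := mul_le_mul_of_nonneg_left hl1 hab0.le
  have D4 := mul_le_mul_of_nonneg_left hl2 hab0.le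
  have hd : 2 * d * N = 2 * d * (a * a + b * b) := by rw [hNN]
  have hc : 2 * c * N = 2 * c * (a * a + b * b) := by rw [hNN]
  have s1 : c + d < a := by
    apply lt_of_mul_lt_mul_right _ hN.le; linarith
  have s2 : c - d < a := by
    apply lt_of_mul_lt_mul_right _ hN.le; linarith
  have s3 : -c + d < a := by
    apply lt_of_mul_lt_mul_right _ hN.le; linarith
  have s4 : -c - d < a := by
    apply lt_of_mul_lt_mul_right _ hN.le; linarith
  clear A1 A2 A3 A4 B1 B2 B3 B4 D1 D2 D3 D4 hm1 hm2 hl1 hl2 hd hc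
  by_cases h1 : d ≤ c
  · by_cases h2 : -d ≤ c
    · exact Good_sector hb hab ho ha hs h1 h2 c1 s1 s2
    · have : Good n a b (-d) c :=
        Good_sector hb hab ho ha hs (by omega) (by omega) (by omega) (by omega) (by omega)
      simpa using Good_rot (Good_rot (Good_rot this))
  · by_cases h2 : -d ≤ c
    · have : Good n a b d (-c) :=
        Good_sector hb hab ho ha hs (by omega) (by omega) (by omega) (by omega) (by omega)
      simpa using Good_rot this
    · have : Good n a b (-c) (-d) :=
        Good_sector hb hab ho ha hs (by omega) (by omega) (by omega) (by omega) (by omega)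
      simpa using Good_rot (Good_rot this)

lemma Cov_odd' {n : ℕ} {a b : ℤ} (ho : (a + b) % 2 = 1) (h : Bd (n+1) 1 a b) : Cov n a b := by
  have e : n + 1 + 1 = n + 2 := rfl
  unfold Bd at h
  rw [e] at h
  have key : ∀ a b : ℤ, (a + b) % 2 = 1 → b < a → -b < a → a ≤ ww (n+1) - 2 →
      a + b ≤ ww (n+2) - 3 → a - b ≤ ww (n+2) - 3 → Cov n a b := by
    intro a b ho h1 h2 h3 h4 h5
    rcases le_or_gt 0 b with hb | hb
    · exact Cov_odd hb h1 ho h3 h4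
    · have : Cov n a (-b) := Cov_odd (by omega) (by omega) (by omega) h3 (by omega)
      simpa using Cov_rot (Cov_rot (Cov_rot (Cov_swap this)))
  by_cases h1 : b < a
  · by_cases h2 : -b < a
    · exact key a b ho h1 h2 (by omega) (by omega) (by omega)
    · have : Cov n (-b) a := key _ _ (by omega) (by omega) (by omega) (by omega) (by omega) (by omega)
      simpa using Cov_rot (Cov_rot (Cov_rot this))
  · by_cases h2 : -b < a
    · have : Cov n b (-a) := key _ _ (by omega) (by omega) (by omega) (by omega) (by omega) (by omega)
      simpa using Cov_rot this
    · have : Cov n (-a) (-b) :=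
        key _ _ (by omega) (by omega) (by omega) (by omega) (by omega) (by omega)
      simpa using Cov_rot (Cov_rot this)

lemma InC_mul_add {n : ℕ} {x y : ℤ} (h : InC n x y) : InC (n+1) (x - y + 1) (x + y) := by
  obtain ⟨k, hk⟩ := ww_form n
  have hP : (0:ℤ) < 2^k := by positivity
  have e : ww (n + 1 + 1) = 2 * ww n := rfl
  apply InC_odd (by omega)
  rcases h with h | h
  · unfold Bd
    rw [e]
    omega
  · have := h 0 (by simp) (by simp)
    unfold Bd at *
    rw [e]
    simp only [pow_zero] at this
    omega

lemma InC_mul {n : ℕ} {x y : ℤ} (h : InC n x y) : InC (n+1) (x - y) (x + y) := by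
  rcases h with h | h
  · left; omega
  · right
    intro j h1 h2
    have e : ww (n + 1 + 1) = 2 * ww n := rfl
    rcases Nat.eq_zero_or_pos j with rfl | hj
    · have := h 0 (by simp) (by simp)
      unfold Bd at *
      rw [e]
      simp only [pow_zero] at *
      omega
    obtain ⟨i, rfl⟩ : ∃ i, j = i + 1 := ⟨j - 1, by omega⟩
    obtain ⟨u, hu⟩ := h1
    obtain ⟨v, hv⟩ := h2
    have hF : (0:ℤ) < 2^i := by positivity
    have hx : x = 2^i * (v + u) := by rw [pow_succ] at *; linarith
    have hy : y = 2^i * (v - u) := by rw [pow_succ] at *; linarith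
    have hb := h i ⟨_, hx⟩ ⟨_, hy⟩
    by_cases hpar : (v + u) % 2 = 0
    · have hb2 := h (i+1) (by rw [hx, pow_succ]; exact mul_dvd_mul_left _ (by omega))
        (by rw [hy, pow_succ]; exact mul_dvd_mul_left _ (by omega))
      unfold Bd at *
      rw [e]
      have : (0:ℤ) < 2^(i+1) := by positivity
      omega
    · have hz1 : v + u ≥ 1 ∨ v + u ≤ -1 := by omega
      have hz2 : v - u ≥ 1 ∨ v - u ≤ -1 := by omega
      have hx1 : x ≥ 2^i ∨ x ≤ -2^i := by
        rw [hx]; rcases hz1 with q | q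
        · left; nlinarith
        · right; nlinarith
      have hy1 : y ≥ 2^i ∨ y ≤ -2^i := by
        rw [hy]; rcases hz2 with q | q
        · left; nlinarith
        · right; nlinarith
      have fin : ∀ s t : ℤ, ww n = 2^i * (2*s) → ww (n+1) = 2^i * (2*t) →
          Bd (n+1) (2^(i+1)) (x - y) (x + y) := by
        intro s t hs ht
        unfold Bd at *
        rw [e, pow_succ]
        obtain ⟨b1, b2, b3, b4, b5, b6, b7, b8⟩ := hb
        have par : ∀ z T : ℤ, z % 2 = 1 → 2^i * z ≤ 2^i * (2*T) - 2 * 2^i →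
            2^i * z ≤ 2^i * (2*T-3) := by
          intro z T hz hle
          have : z ≤ 2 * T - 2 := by
            apply le_of_mul_le_mul_left _ hF; linarith
          exact (le_of_scaled hF).2 (by omega)
        have par' : ∀ z T : ℤ, z % 2 = 0 → 2^i * z ≤ 2^i * (2*T) - 3 * 2^i →
            2^i * z ≤ 2^i * (2*T-4) := by
          intro z T hz hle
          have : z ≤ 2 * T - 3 := by
            apply le_of_mul_le_mul_left _ hF; linarith
          exact (le_of_scaled hF).2 (by omega)
        have f1 := par (v+u) s (by omega) (by linarith)
        have f2 := par (-(v+u)) s (by omega) (by linarith)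
        have f3 := par (v-u) s (by omega) (by linarith)
        have f4 := par (-(v-u)) s (by omega) (by linarith)
        have f5 := par' (2*v) t (by omega) (by linarith)
        have f6 := par' (-2*v) t (by omega) (by linarith)
        have f7 := par' (2*u) t (by omega) (by linarith)
        have f8 := par' (-2*u) t (by omega) (by linarith)
        refine ⟨?_, ?_, ?_, ?_, ?_, ?_, ?_, ?_⟩ <;> linarith
      obtain ⟨k, hk⟩ := ww_form n
      have hP : (0:ℤ) < 2^k := by positivity
      rcases two_pow_cases i k with g | ⟨m, hm, g⟩ | ⟨m, hm, g⟩
      · rcases hk with ⟨_, k1, k2⟩ | ⟨_, k1, k2⟩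
        · exfalso
          unfold Bd at hb
          omega
        · exact fin 2 3 (by rw [k1, g]; ring) (by rw [k2, g]; ring)
      · rcases hk with ⟨_, k1, k2⟩ | ⟨_, k1, k2⟩
        · exact fin (3*m) (4*m) (by rw [k1, g]; ring) (by rw [k2, g]; ring)
        · exact fin (4*m) (6*m) (by rw [k1, g]; ring) (by rw [k2, g]; ring)
      · exfalso
        have : (2:ℤ)^i ≥ 2 * 2^k := by rw [g]; nlinarith
        unfold Bd at hb
        omega

lemma InC_div {n : ℕ} {x y : ℤ} (h : InC (n+1) (x - y) (x + y)) : InC n x y := by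
  rcases h with h | h
  · left; omega
  · right
    intro j h1 h2
    have e : ww (n + 1 + 1) = 2 * ww n := rfl
    have hb := h j (dvd_sub h1 h2) (dvd_add h1 h2)
    obtain ⟨u, hu⟩ := h1
    obtain ⟨v, hv⟩ := h2
    have hF : (0:ℤ) < 2^j := by positivity
    have fin : ∀ s t : ℤ, ww n = 2^j * s → ww (n+1) = 2^j * (2*t) →
        Bd n (2^j) x y := by
      intro s t hs ht
      by_cases hpar : (u + v) % 2 = 0
      · have hb2 := h (j+1)
          (by rw [hu, hv, pow_succ, ← mul_sub]; exact mul_dvd_mul_left _ (by omega))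
          (by rw [hu, hv, pow_succ, ← mul_add]; exact mul_dvd_mul_left _ (by omega))
        unfold Bd at *
        rw [e] at hb hb2
        rw [pow_succ] at hb2
        omega
      · unfold Bd at *
        rw [e] at hb
        obtain ⟨b1, b2, b3, b4, b5, b6, b7, b8⟩ := hb
        have par : ∀ z : ℤ, z % 2 = 1 → 2^j * z ≤ 2^j * (2*t) - 2 * 2^j →
            2^j * z ≤ 2^j * (2*t-3) := by
          intro z hz hle
          have : z ≤ 2 * t - 2 := by
            apply le_of_mul_le_mul_left _ hF; linarith
          exact (le_of_scaled hF).2 (by omega)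
        have par' : ∀ z : ℤ, 2^j * (2*z) ≤ 2 * (2^j * s) - 3 * 2^j →
            2^j * z ≤ 2^j * (s-2) := by
          intro z hle
          have : 2 * z ≤ 2 * s - 3 := by
            apply le_of_mul_le_mul_left _ hF; linarith
          exact (le_of_scaled hF).2 (by omega)
        have f1 := par (u+v) (by omega) (by linarith)
        have f2 := par (-(u+v)) (by omega) (by linarith)
        have f3 := par (u-v) (by omega) (by linarith)
        have f4 := par (-(u-v)) (by omega) (by linarith)
        have f5 := par' u (by linarith)
        have f6 := par' (-u) (by linarith)
        have f7 := par' v (by linarith)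
        have f8 := par' (-v) (by linarith)
        refine ⟨?_, ?_, ?_, ?_, ?_, ?_, ?_, ?_⟩ <;> linarith
    obtain ⟨k, hk⟩ := ww_form n
    have hP : (0:ℤ) < 2^k := by positivity
    rcases two_pow_cases j k with g | ⟨m, hm, g⟩ | ⟨m, hm, g⟩
    · rcases hk with ⟨_, k1, k2⟩ | ⟨_, k1, k2⟩
      · exact fin 3 2 (by rw [k1, g]; ring) (by rw [k2, g]; ring)
      · exact fin 4 3 (by rw [k1, g]; ring) (by rw [k2, g]; ring)
    · rcases hk with ⟨_, k1, k2⟩ | ⟨_, k1, k2⟩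
      · exact fin (6*m) (4*m) (by rw [k1, g]; ring) (by rw [k2, g]; ring)
      · exact fin (8*m) (6*m) (by rw [k1, g]; ring) (by rw [k2, g]; ring)
    · exfalso
      have hEP : (2:ℤ)^j ≥ 2 * 2^k := by rw [g]; nlinarith
      have small : ∀ z w : ℤ, z = 2^j * w → -2^j < z → z < 2^j → z = 0 := by
        intro z w hz g1 g2
        have q1 : w < 1 := by
          apply lt_of_mul_lt_mul_left _ hF.le; linarith
        have q2 : -1 < w := by
          apply lt_of_mul_lt_mul_left _ hF.le; linarith
        have : w = 0 := by omega
        rw [hz, this, mul_zero]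
      unfold Bd at hb
      rw [e] at hb
      have hx0 : x = 0 := small x u hu (by omega) (by omega)
      have hy0 : y = 0 := small y v hv (by omega) (by omega)
      have hb3 := h (k+2) (by simp [hx0, hy0]) (by simp [hx0, hy0])
      unfold Bd at hb3
      rw [pow_add] at hb3
      omega

lemma InC_zero_iff {x y : ℤ} : InC 0 x y ↔ (x = 0 ∧ y = 0) ∨ (x = 1 ∧ y = 0) ∨ (x = -1 ∧ y = 0) ∨
    (x = 0 ∧ y = 1) ∨ (x = 0 ∧ y = -1) := by
  constructor
  · rintro (h | h)
    · exact Or.inl h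
    · have := h 0 (by simp) (by simp)
      unfold Bd at this
      simp [ww] at this
      omega
  · rintro (h | h)
    · exact Or.inl h
    · apply InC_odd (by omega)
      unfold Bd
      simp only [ww]
      omega

lemma Cov_all (n : ℕ) : ∀ a b : ℤ, ¬ (a = 0 ∧ b = 0) → InC (n+1) a b → Cov n a b := by
  induction n with
  | zero =>
    intro a b h0 h
    by_cases ho : (a + b) % 2 = 1
    · apply Cov_odd' ho
      rcases h with h | h
      · exact absurd h h0
      · simpa using h 0 (by simp) (by simp)
    · obtain ⟨s, t, rfl, rfl⟩ : ∃ s t : ℤ, a = s - t ∧ b = s + t :=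
        ⟨(a+b)/2, (b-a)/2, by omega, by omega⟩
      have h1 := InC_div h
      rw [InC_zero_iff] at h1
      intro x y
      have hst : s * s + t * t = 1 := by
        rcases h1 with ⟨rfl, rfl⟩ | ⟨rfl, rfl⟩ | ⟨rfl, rfl⟩ | ⟨rfl, rfl⟩ | ⟨rfl, rfl⟩ <;> simp at h0 ⊢
      have key : ∀ u v : ℤ, ∃ p q : ℤ, s * p - t * q = u ∧ s * q + t * p = v := by
        intro u v
        refine ⟨s * u + t * v, s * v - t * u, ?_, ?_⟩
        · linear_combination u * hst
        · linear_combination v * hst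
      by_cases hxy : (x + y) % 2 = 0
      · obtain ⟨p, q, h3, h4⟩ := key ((x+y)/2) ((y-x)/2)
        refine ⟨p, q, Or.inl ?_⟩
        have : (s - t) * p - (s + t) * q = (x+y)/2 - (y-x)/2 := by rw [← h3, ← h4]; ring
        have : (s - t) * q + (s + t) * p = (x+y)/2 + (y-x)/2 := by rw [← h3, ← h4]; ring
        omega
      · obtain ⟨p, q, h3, h4⟩ := key ((x-1+y)/2) ((y-(x-1))/2)
        refine ⟨p, q, InC_zero_iff.2 (Or.inr (Or.inl ?_))⟩
        have : (s - t) * p - (s + t) * q = (x-1+y)/2 - (y-(x-1))/2 := by rw [← h3, ← h4]; ring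
        have : (s - t) * q + (s + t) * p = (x-1+y)/2 + (y-(x-1))/2 := by rw [← h3, ← h4]; ring
        omega
  | succ n ih =>
    intro a b h0 h
    by_cases ho : (a + b) % 2 = 1
    · apply Cov_odd' ho
      rcases h with h | h
      · exact absurd h h0
      · simpa using h 0 (by simp) (by simp)
    · obtain ⟨s, t, rfl, rfl⟩ : ∃ s t : ℤ, a = s - t ∧ b = s + t :=
        ⟨(a+b)/2, (b-a)/2, by omega, by omega⟩
      have h1 := ih s t (by omega) (InC_div h)
      intro x y
      by_cases hxy : (x + y) % 2 = 0
      · obtain ⟨u, v, rfl, rfl⟩ : ∃ u v : ℤ, x = u - v ∧ y = u + v :=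
          ⟨(x+y)/2, (y-x)/2, by omega, by omega⟩
        obtain ⟨p, q, h2⟩ := h1 u v
        refine ⟨p, q, ?_⟩
        convert InC_mul h2 using 1 <;> ring
      · obtain ⟨u, v, hx, rfl⟩ : ∃ u v : ℤ, x = u - v + 1 ∧ y = u + v :=
          ⟨(x-1+y)/2, (y-(x-1))/2, by omega, by omega⟩
        obtain ⟨p, q, h2⟩ := h1 u v
        refine ⟨p, q, ?_⟩
        rw [hx]
        convert InC_mul_add h2 using 1 <;> ring

lemma InC_of_mul {n : ℕ} {s t u v : ℤ} (h0 : ¬ (s * u - t * v = 0 ∧ s * v + t * u = 0))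
    (h : InC n (s * u - t * v) (s * v + t * u)) : InC n s t := by
  have hN : (s * u - t * v)^2 + (s * v + t * u)^2 = (s^2 + t^2) * (u^2 + v^2) := by ring
  by_cases huv : u^2 + v^2 ≤ 1
  · have hu1 : u ≤ 1 := by nlinarith
    have hu2 : -1 ≤ u := by nlinarith
    have hv1 : v ≤ 1 := by nlinarith
    have hv2 : -1 ≤ v := by nlinarith
    have hu : u = -1 ∨ u = 0 ∨ u = 1 := by omega
    have hv : v = -1 ∨ v = 0 ∨ v = 1 := by omega
    rcases hu with rfl | rfl | rfl <;> rcases hv with rfl | rfl | rfl <;>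
      norm_num at huv <;> (try norm_num at h0) <;> norm_num at h
    · simpa using InC_rot (InC_rot h)
    · simpa using InC_rot h
    · simpa using InC_rot (InC_rot (InC_rot h))
    · exact h
  · push Not at huv
    rcases h with h | h
    · exact absurd h h0
    right
    intro j hs ht
    have hb := h j (dvd_sub (hs.mul_right _) (ht.mul_right _))
      (dvd_add (hs.mul_right _) (ht.mul_right _))
    generalize s * u - t * v = x at *
    generalize s * v + t * u = y at *
    have h2 : 2 * (s^2 + t^2) ≤ x^2 + y^2 := by
      rw [hN]; nlinarith [sq_nonneg s, sq_nonneg t]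
    unfold Bd at *
    generalize ww n - 2 * 2^j = A at *
    generalize ww (n+1) - 3 * 2^j = S at *
    obtain ⟨b1, b2, b3, b4, b5, b6, b7, b8⟩ := hb
    have hA : 0 ≤ A := by omega
    have hS : 0 ≤ S := by omega
    have hx2 : x^2 ≤ A^2 := sq_le_sq' (by omega) b1
    have hy2 : y^2 ≤ A^2 := sq_le_sq' (by omega) b3
    have p1 : (x+y)^2 ≤ S^2 := sq_le_sq' (by omega) b5
    have p2 : (x-y)^2 ≤ S^2 := sq_le_sq' (by omega) b6
    have hs2 : s^2 ≤ A^2 := by nlinarith [sq_nonneg t]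
    have ht2 : t^2 ≤ A^2 := by nlinarith [sq_nonneg s]
    have q1 : (s+t)^2 ≤ S^2 := by nlinarith [sq_nonneg (s-t)]
    have q2 : (s-t)^2 ≤ S^2 := by nlinarith [sq_nonneg (s+t)]
    have r1 := abs_le_of_sq_le_sq' hs2 hA
    have r2 := abs_le_of_sq_le_sq' ht2 hA
    have r3 := abs_le_of_sq_le_sq' q1 hS
    have r4 := abs_le_of_sq_le_sq' q2 hS
    omega

lemma top_elem (n : ℕ) : ∃ X Y : ℤ, ∀ x y : ℤ, InC n x y →
    ¬ (X - x = 0 ∧ Y - y = 0) ∧ InC (n+1) (X - x) (Y - y) := by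
  obtain ⟨k, hk⟩ := ww_form n
  have hP : (0:ℤ) < 2^k := by positivity
  have e : ww (n + 1 + 1) = 2 * ww n := rfl
  have odd_mult : ∀ Q z : ℤ, 0 < Q → 2 * Q ∣ Q - z → Q ≤ z ∨ z ≤ -Q := by
    rintro Q z hQ ⟨c, hc⟩
    have : z = Q * (1 - 2 * c) := by linarith
    rcases le_or_gt 1 c with q | q
    · right; nlinarith
    · left
      have : c ≤ 0 := by omega
      nlinarith
  rcases hk with ⟨_, k1, k2⟩ | ⟨_, k1, k2⟩
  · refine ⟨2^k, 2^k, ?_⟩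
    intro x y h
    have hnd : (2 * 2^k ∣ 2^k - x) → (2 * 2^k ∣ 2^k - y) → False := by
      intro g1 g2
      have hx := odd_mult _ _ hP g1
      have hy := odd_mult _ _ hP g2
      rcases h with h | h
      · omega
      · have := h k (by have := dvd_sub (dvd_refl ((2:ℤ)^k)) ((Dvd.intro_left _ rfl).trans g1); simpa using this)
          (by have := dvd_sub (dvd_refl ((2:ℤ)^k)) ((Dvd.intro_left _ rfl).trans g2); simpa using this)
        unfold Bd at this
        omega
    refine ⟨fun hh => hnd (by rw [hh.1]; simp) (by rw [hh.2]; simp), ?_⟩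
    right
    intro j g1 g2
    have hjk : j ≤ k := by
      by_contra hcon
      have : (2:ℤ) * 2^k ∣ 2^j := by
        rw [← pow_succ']; exact pow_dvd_pow _ (by omega)
      exact hnd (this.trans g1) (this.trans g2)
    have hd : (2:ℤ)^j ∣ 2^k := pow_dvd_pow _ hjk
    have hle : (2:ℤ)^j ≤ 2^k := Int.le_of_dvd hP hd
    have hF : (0:ℤ) < 2^j := by positivity
    unfold Bd
    rw [e]
    rcases h with h | h
    · omega
    · have := h j (by simpa using dvd_sub hd g1) (by simpa using dvd_sub hd g2)
      unfold Bd at this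
      omega
  · refine ⟨2 * 2^k, 0, ?_⟩
    intro x y h
    have hnd : (2 * (2 * 2^k) ∣ 2 * 2^k - x) → (2 * (2 * 2^k) ∣ 0 - y) → False := by
      intro g1 g2
      have hx := odd_mult _ _ (by omega) g1
      rcases h with h | h
      · omega
      · have := h (k+1) (by have := dvd_sub (dvd_refl (2 * (2:ℤ)^k)) ((Dvd.intro_left _ rfl).trans g1); rw [pow_succ']; simpa using this)
          (by have := ((Dvd.intro_left _ rfl).trans g2 : (2 * (2:ℤ)^k ∣ 0 - y)); rw [pow_succ']; simpa using this)
        unfold Bd at this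
        rw [pow_succ'] at this
        omega
    refine ⟨fun hh => hnd (by rw [hh.1]; simp) (by rw [hh.2]; simp), ?_⟩
    right
    intro j g1 g2
    have hjk : j ≤ k + 1 := by
      by_contra hcon
      have : (2:ℤ) * (2 * 2^k) ∣ 2^j := by
        rw [← pow_succ', ← pow_succ']; exact pow_dvd_pow _ (by omega)
      exact hnd (this.trans g1) (this.trans g2)
    have hd : (2:ℤ)^j ∣ 2 * 2^k := by rw [← pow_succ']; exact pow_dvd_pow _ hjk
    have hle : (2:ℤ)^j ≤ 2 * 2^k := Int.le_of_dvd (by omega) hd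
    have hF : (0:ℤ) < 2^j := by positivity
    unfold Bd
    rw [e]
    rcases h with h | h
    · omega
    · have := h j (by simpa using dvd_sub hd g1) (by simpa using g2)
      unfold Bd at this
      omega

theorem motz_eq (n : ℕ) : MotzkinSet n = {z | InC n z.re z.im} := by
  induction n with
  | zero =>
    ext z
    simp only [MotzkinSet, Set.mem_ofPred_eq, InC_zero_iff]
    constructor
    · rintro (rfl | h)
      · left; exact ⟨rfl, rfl⟩
      · right
        rw [Zsqrtd.isUnit_iff_norm_isUnit, Int.isUnit_iff] at h
        have h1 : z.re * z.re + z.im * z.im = 1 := by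
          rw [Zsqrtd.norm_def] at h
          rcases h with h | h
          · linarith
          · nlinarith
        have u1 : z.re ≤ 1 := by nlinarith
        have u2 : -1 ≤ z.re := by nlinarith
        have v1 : z.im ≤ 1 := by nlinarith
        have v2 : -1 ≤ z.im := by nlinarith
        have hu : z.re = -1 ∨ z.re = 0 ∨ z.re = 1 := by omega
        have hv : z.im = -1 ∨ z.im = 0 ∨ z.im = 1 := by omega
        rcases hu with hu | hu | hu <;> rcases hv with hv | hv | hv <;>
          rw [hu, hv] at h1 ⊢ <;> first | (exfalso; revert h1; norm_num; done) | norm_num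
    · rintro (h | h)
      · left; exact Zsqrtd.ext h.1 h.2
      · right
        rw [Zsqrtd.isUnit_iff_norm_isUnit, Int.isUnit_iff, Zsqrtd.norm_def]
        left
        rcases h with h | h | h | h <;> rw [h.1, h.2] <;> norm_num
  | succ n ih =>
    ext β
    simp only [MotzkinSet, ih, Set.mem_union, Set.mem_ofPred_eq]
    constructor
    · rintro (h | h)
      · exact InC_mono h
      · obtain ⟨X, Y, hXY⟩ := top_elem n
        obtain ⟨r, hr, c, hc⟩ := h ⟨X, Y⟩
        obtain ⟨h1, h2⟩ := hXY _ _ hr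
        have e1 : X - r.re = β.re * c.re - β.im * c.im := by
          have := congrArg Zsqrtd.re hc
          simp at this
          linarith
        have e2 : Y - r.im = β.re * c.im + β.im * c.re := by
          have := congrArg Zsqrtd.im hc
          simpa using this
        rw [e1, e2] at h1 h2
        exact InC_of_mul h1 h2
    · intro h
      by_cases h0 : β.re = 0 ∧ β.im = 0
      · left; left; exact h0
      · right
        intro x
        obtain ⟨p, q, hpq⟩ := Cov_all n _ _ h0 h x.re x.im
        refine ⟨⟨_, _⟩, hpq, ⟨p, q⟩, ?_⟩
        apply Zsqrtd.ext
        · simp; ring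
        · simp


noncomputable def TT (M S : ℤ) : Finset (ℤ × ℤ) :=
  (Finset.Icc (-M) M ×ˢ Finset.Icc (-M) M).filter
    (fun p => p.1 + p.2 ≤ S ∧ p.1 - p.2 ≤ S ∧ -p.1 + p.2 ≤ S ∧ -p.1 - p.2 ≤ S)

lemma sum_sym (g : ℤ → ℤ) (N : ℕ) : ∑ x ∈ Finset.Icc (-((N+1 : ℕ):ℤ)) ((N+1 : ℕ):ℤ), g x =
    ∑ x ∈ Finset.Icc (-(N:ℤ)) N, g x + g (N+1) + g (-(N+1)) := by
  have : Finset.Icc (-((N+1 : ℕ):ℤ)) ((N+1 : ℕ):ℤ) =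
      insert (-((N:ℤ)+1)) (insert ((N:ℤ)+1) (Finset.Icc (-(N:ℤ)) N)) := by
    ext x
    simp only [Finset.mem_Icc, Finset.mem_insert]
    omega
  rw [this, Finset.sum_insert, Finset.sum_insert]
  · ring
  · simp only [Finset.mem_Icc]; omega
  · simp only [Finset.mem_Icc, Finset.mem_insert]; omega

lemma sum_low (M S : ℤ) (t : ℕ) (hS : S = M + t) : ∀ N : ℕ, N ≤ t →
    ∑ x ∈ Finset.Icc (-(N:ℤ)) N, (2 * min M (S - |x|) + 1) = (2 * N + 1) * (2 * M + 1) := by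
  intro N
  induction N with
  | zero => intro _; simp; omega
  | succ N ih =>
    intro h
    rw [sum_sym, ih (by omega), abs_neg, abs_of_nonneg (by positivity : (0:ℤ) ≤ (N:ℤ) + 1),
      min_eq_left (by omega)]
    push_cast; ring

lemma sum_high (M S : ℤ) (t : ℕ) (hS : S = M + t) : ∀ i : ℕ,
    ∑ x ∈ Finset.Icc (-((t + i : ℕ):ℤ)) ((t + i : ℕ):ℤ), (2 * min M (S - |x|) + 1) =
      (2 * t + 1) * (2 * M + 1) + 4 * i * M - 2 * i^2 := by
  intro i
  induction i with
  | zero => simpa using sum_low M S t hS t le_rfl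
  | succ i ih =>
    rw [← add_assoc, sum_sym, ih, abs_neg, abs_of_nonneg (by positivity : (0:ℤ) ≤ ((t+i:ℕ):ℤ) + 1),
      min_eq_right (by push_cast; omega)]
    push_cast; rw [hS]; ring

lemma TT_card (M t : ℤ) (ht : 0 ≤ t) (htM : t ≤ M) : ((TT M (M + t)).card : ℤ) =
    (2 * t + 1) * (2 * M + 1) + 4 * (M - t) * M - 2 * (M - t)^2 := by
  obtain ⟨t', rfl⟩ := Int.eq_ofNat_of_zero_le ht
  obtain ⟨i, hi⟩ := Int.eq_ofNat_of_zero_le (sub_nonneg.2 htM)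
  have hM : M = ((t' + i : ℕ) : ℤ) := by push_cast; omega
  have := sum_high M (M + t') t' rfl i
  rw [hi, ← this, ← hM, TT, Finset.card_filter, Finset.sum_product]
  push_cast
  apply Finset.sum_congr rfl
  intro x hx
  rw [Finset.mem_Icc] at hx
  rw [← Nat.cast_one, ← Nat.cast_zero]
  have h2 : (Finset.Icc (-M) M).filter (fun y => x + y ≤ M + t' ∧ x - y ≤ M + t' ∧ -x + y ≤ M + t' ∧
      -x - y ≤ M + t') = Finset.Icc (-(min M (M + t' - |x|))) (min M (M + t' - |x|)) := by
    ext y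
    simp only [Finset.mem_filter, Finset.mem_Icc]
    rcases abs_cases x with h | h <;> omega
  have h3 := congrArg (fun s => (s.card : ℤ)) h2
  simp only [Finset.card_filter, Int.card_Icc] at h3
  push_cast at h3 ⊢
  rw [h3, Int.toNat_of_nonneg]
  · ring
  · rcases abs_cases x with h | h <;> omega

def KK (n : ℕ) : Set (ℤ × ℤ) := {p | InC n p.1 p.2}

def OO (n : ℕ) : Set (ℤ × ℤ) := {p | ¬ (2 ∣ p.1 ∧ 2 ∣ p.2) ∧ Bd n 1 p.1 p.2}

def dbl (p : ℤ × ℤ) : ℤ × ℤ := (2 * p.1, 2 * p.2)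

lemma dbl_inj : Function.Injective dbl := by
  rintro ⟨a, b⟩ ⟨c, d⟩ h
  simp only [dbl, Prod.mk.injEq] at h ⊢
  omega

lemma TT_eq (n : ℕ) : (TT (ww n - 2) (ww (n+1) - 3) : Set (ℤ × ℤ)) = {p | Bd n 1 p.1 p.2} := by
  ext p
  simp only [TT, Finset.coe_filter, Finset.mem_product, Finset.mem_Icc, Set.mem_ofPred_eq, Bd]
  omega

lemma OO_fin (n : ℕ) : (OO n).Finite := by
  apply (TT (ww n - 2) (ww (n+1) - 3)).finite_toSet.subset
  rw [TT_eq]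
  exact fun p hp => hp.2

lemma KK_fin (n : ℕ) : (KK n).Finite := by
  apply ((TT (ww n - 2) (ww (n+1) - 3)).finite_toSet.insert (0, 0)).subset
  rw [TT_eq]
  rintro ⟨a, b⟩ (hp | hp)
  · left; simpa using hp
  · right
    simpa using hp 0 (by simp) (by simp)

lemma OO_card (n : ℕ) (M S : ℤ) (h1 : ww n - 2 = 2 * M ∨ ww n - 2 = 2 * M + 1)
    (h2 : ww (n+1) - 3 = 2 * S ∨ ww (n+1) - 3 = 2 * S + 1) :
    (OO n).ncard + (TT M S).card = (TT (ww n - 2) (ww (n+1) - 3)).card := by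
  have hu : (TT (ww n - 2) (ww (n+1) - 3) : Set (ℤ × ℤ)) = OO n ∪ Set.image dbl (TT M S) := by
    rw [TT_eq]
    ext ⟨x, y⟩
    simp only [Set.mem_ofPred_eq, Set.mem_union, OO, Set.mem_image, dbl, TT, Finset.coe_filter,
      Finset.mem_product, Finset.mem_Icc, Prod.exists, Prod.mk.injEq]
    constructor
    · intro h
      by_cases hd : (2:ℤ) ∣ x ∧ (2:ℤ) ∣ y
      · right
        refine ⟨x / 2, y / 2, ?_, by omega, by omega⟩
        unfold Bd at h
        omega
      · left; exact ⟨hd, h⟩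
    · rintro (h | ⟨a, b, h, rfl, rfl⟩)
      · exact h.2
      · unfold Bd
        omega
  rw [← Set.ncard_coe_finset (TT (ww n - 2) _), hu, Set.ncard_union_eq _ (OO_fin n)
    ((TT M S).finite_toSet.image _), Set.ncard_image_of_injective _ dbl_inj, Set.ncard_coe_finset]
  rw [Set.disjoint_left]
  rintro p hp ⟨q, _, rfl⟩
  exact hp.1 ⟨by simp [dbl], by simp [dbl]⟩

lemma KK_succ (n : ℕ) : (KK (n+2)).ncard = (OO (n+2)).ncard + (KK n).ncard := by
  have e1 : ww (n+2) = 2 * ww n := rfl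
  have e2 : ww (n+2+1) = 2 * ww (n+1) := rfl
  have hu : KK (n+2) = OO (n+2) ∪ Set.image dbl (KK n) := by
    ext ⟨x, y⟩
    simp only [Set.mem_ofPred_eq, Set.mem_union, OO, KK, Set.mem_image, dbl, Prod.exists,
      Prod.mk.injEq]
    constructor
    · intro h
      by_cases hd : (2:ℤ) ∣ x ∧ (2:ℤ) ∣ y
      · right
        obtain ⟨⟨a, rfl⟩, ⟨b, rfl⟩⟩ := hd
        refine ⟨a, b, ?_, rfl, rfl⟩
        rcases h with h | h
        · left; omega
        · right
          intro j ha hb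
          have := h (j+1) (by rw [pow_succ']; exact mul_dvd_mul_left _ ha)
            (by rw [pow_succ']; exact mul_dvd_mul_left _ hb)
          unfold Bd at *
          rw [e1, e2, pow_succ'] at this
          omega
      · left
        refine ⟨hd, ?_⟩
        rcases h with h | h
        · exact absurd ⟨by simp [h.1], by simp [h.2]⟩ hd
        · simpa using h 0 (by simp) (by simp)
    · rintro (h | ⟨a, b, h, rfl, rfl⟩)
      · right
        intro j hx hy
        rcases Nat.eq_zero_or_pos j with rfl | hj
        · simpa using h.2
        · exfalso
          have h2 : (2:ℤ) ∣ 2^j := dvd_pow_self _ (by omega)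
          exact h.1 ⟨h2.trans hx, h2.trans hy⟩
      · rcases h with h | h
        · left; omega
        · right
          have base := h 0 (by simp) (by simp)
          intro j hx hy
          rcases Nat.eq_zero_or_pos j with rfl | hj
          · unfold Bd at *
            rw [e1, e2]
            simp only [pow_zero] at *
            omega
          · obtain ⟨i, rfl⟩ : ∃ i, j = i + 1 := ⟨j - 1, by omega⟩
            rw [pow_succ'] at hx hy ⊢
            have := h i ((mul_dvd_mul_iff_left (by norm_num)).1 hx)
              ((mul_dvd_mul_iff_left (by norm_num)).1 hy)
            unfold Bd at *
            rw [e1, e2]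
            omega
  rw [hu, Set.ncard_union_eq _ (OO_fin _) ((KK_fin n).image _),
    Set.ncard_image_of_injective _ dbl_inj]
  rw [Set.disjoint_left]
  rintro p hp ⟨q, _, rfl⟩
  exact hp.1 ⟨by simp [dbl], by simp [dbl]⟩

lemma KK_zero : (KK 0).ncard = 5 := by
  have : KK 0 = (({(0,0),(1,0),(-1,0),(0,1),(0,-1)} : Finset (ℤ × ℤ)) : Set (ℤ × ℤ)) := by
    ext ⟨x, y⟩
    simp [KK, InC_zero_iff]
  rw [this, Set.ncard_coe_finset]
  rfl

lemma KK_one : (KK 1).ncard = (OO 1).ncard + 1 := by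
  have hu : KK 1 = insert (0, 0) (OO 1) := by
    ext ⟨x, y⟩
    simp only [Set.mem_ofPred_eq, Set.mem_insert_iff, OO, KK, Prod.mk.injEq]
    constructor
    · rintro (h | h)
      · exact Or.inl h
      · right
        have h0 := h 0 (by simp) (by simp)
        simp only [pow_zero] at h0
        refine ⟨?_, h0⟩
        intro hd
        have h1 := h 1 (by simpa using hd.1) (by simpa using hd.2)
        have h2 := h 2
        unfold Bd at h1 h2
        simp only [ww] at h1 h2
        have hx : x = 0 := by omega
        have hy : y = 0 := by omega
        have := h2 (by simp [hx]) (by simp [hy])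
        omega
    · rintro (h | h)
      · exact Or.inl h
      · right
        intro j hx hy
        rcases Nat.eq_zero_or_pos j with rfl | hj
        · simpa using h.2
        · exfalso
          have h2 : (2:ℤ) ∣ 2^j := dvd_pow_self _ (by omega)
          exact h.1 ⟨h2.trans hx, h2.trans hy⟩
  rw [hu, Set.ncard_insert_of_notMem _ (OO_fin 1)]
  intro h
  exact h.1 ⟨by simp, by simp⟩

lemma ww_even (k : ℕ) : ww (2 * k) = 3 * 2^k ∧ ww (2 * k + 1) = 4 * 2^k := by
  obtain ⟨k', ⟨h, h1, h2⟩ | ⟨h, h1, h2⟩⟩ := ww_form (2 * k)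
  · have : k' = k := by omega
    subst this
    exact ⟨h1, h2⟩
  · omega

lemma OO_card_odd (k : ℕ) : ((OO (2 * k + 1)).ncard : ℤ) = 42 * 4^k - 34 * 2^k + 8 := by
  have h1 := (ww_even k).2
  have h2 : ww (2 * k + 1 + 1) = 6 * 2^k := by rw [ww_two, (ww_even k).1]; ring
  have h4 : (4:ℤ)^k = 2^k * 2^k := by rw [← mul_pow]; norm_num
  have hP : (0:ℤ) < 2^k := by positivity
  have := OO_card (2 * k + 1) (2 * 2^k - 1) (2 * 2^k - 1 + (2^k - 1)) (by omega) (by omega)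
  rw [h1, h2] at this
  have c1 := TT_card (2 * 2^k - 1) (2^k - 1) (by omega) (by omega)
  have c2 := TT_card (4 * 2^k - 2) (2 * 2^k - 1) (by omega) (by omega)
  rw [show (4 * 2^k - 2 + (2 * 2^k - 1) : ℤ) = 6 * 2^k - 3 by ring] at c2
  zify at this
  rw [c1, c2] at this
  rw [h4]
  linear_combination this

lemma OO_card_even (k : ℕ) : ((OO (2 * (k + 1))).ncard : ℤ) = 21 * 4^(k+1) - 24 * 2^(k+1) + 8 := by
  have h1 := (ww_even (k+1)).1
  have h2 := (ww_even (k+1)).2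
  rw [pow_succ'] at h1 h2
  have h4 : (4:ℤ)^k = 2^k * 2^k := by rw [← mul_pow]; norm_num
  have hP : (0:ℤ) < 2^k := by positivity
  have := OO_card (2 * (k + 1)) (3 * 2^k - 1) (3 * 2^k - 1 + (2^k - 1)) (by omega) (by omega)
  rw [h1, h2] at this
  have c1 := TT_card (3 * 2^k - 1) (2^k - 1) (by omega) (by omega)
  have c2 := TT_card (3 * (2 * 2^k) - 2) (2 * 2^k - 1) (by omega) (by omega)
  rw [show (3 * (2 * 2^k) - 2 + (2 * 2^k - 1) : ℤ) = 4 * (2 * 2^k) - 3 by ring] at c2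
  zify at this
  rw [c1, c2] at this
  rw [pow_succ', pow_succ', h4]
  linear_combination this

lemma KK_card_odd (k : ℕ) : ((KK (2 * k + 1)).ncard : ℤ) =
    14 * 4 ^ (k + 1) - 34 * 2 ^ (k + 1) + 8 * k + 29 := by
  induction k with
  | zero =>
    have := OO_card_odd 0
    have h := KK_one
    zify at h
    simp at this ⊢
    rw [h, this]; norm_num
  | succ k ih =>
    have h := KK_succ (2 * k + 1)
    have h2 := OO_card_odd (k + 1)
    rw [show 2 * (k + 1) + 1 = 2 * k + 1 + 2 by ring] at h2 ⊢
    rw [h]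
    push_cast
    rw [h2, ih]
    ring

lemma KK_card_even (k : ℕ) : ((KK (2 * (k + 1))).ncard : ℤ) =
    28 * 4 ^ (k + 1) - 48 * 2 ^ (k + 1) + 8 * (k + 1) + 25 := by
  induction k with
  | zero =>
    have h2 := OO_card_even 0
    have h := KK_succ 0
    rw [KK_zero] at h
    zify at h
    simp at h2 h ⊢
    rw [h, h2]; norm_num
  | succ k ih =>
    have h := KK_succ (2 * (k + 1))
    have h2 := OO_card_even (k + 1)
    rw [show 2 * (k + 1 + 1) = 2 * (k + 1) + 2 by ring] at h2 ⊢
    rw [h]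
    push_cast
    rw [h2, ih]
    ring


lemma motz_ncard (n : ℕ) : (MotzkinSet n).ncard = (KK n).ncard := by
  have : KK n = Set.image (fun z : GaussianInt => (z.re, z.im)) (MotzkinSet n) := by
    rw [motz_eq]
    ext ⟨x, y⟩
    constructor
    · intro h
      exact ⟨⟨x, y⟩, h, rfl⟩
    · rintro ⟨z, hz, h⟩
      rw [← h]
      exact hz
  rw [this, Set.ncard_image_of_injective]
  intro a b h
  simp only [Prod.mk.injEq] at h
  exact Zsqrtd.ext h.1 h.2

theorem motzkin_card :
    (∀ k : ℕ, ((MotzkinSet (2 * k + 1)).ncard : ℤ) =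
        14 * 4 ^ (k + 1) - 34 * 2 ^ (k + 1) + 8 * k + 29) ∧
    (∀ k : ℕ, 1 ≤ k → ((MotzkinSet (2 * k)).ncard : ℤ) =
        28 * 4 ^ k - 48 * 2 ^ k + 8 * k + 25) := by
  constructor
  · intro k
    rw [motz_ncard]
    exact KK_card_odd k
  · intro k hk
    obtain ⟨l, rfl⟩ : ∃ l, k = l + 1 := ⟨k - 1, by omega⟩
    rw [motz_ncard, KK_card_even]
    push_cast
    ring
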